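/- Let m, n, r ∈ ℕ with r < min(m, n) and let X ∈ ℝ^{m×n} with rank X ≤ r. Then the tangent cone to ℝ_{≤r}^{m×n} at X (in the sense of sequences) equals the algebraic tangent cone to ℝ_{≤r}^{m×n} at X. -/

import Mathlib

open Matrix

/-- The (Bouligand/sequential) tangent cone to a set of matrices at a point. -/
def seqTangentCone {m n : ℕ} (S : Set (Matrix (Fin m) (Fin n) ℝ))
    (X : Matrix (Fin m) (Fin n) ℝ) : Set (Matrix (Fin m) (Fin n) ℝ) :=
  {Z | ∃ (Y : ℕ → Matrix (Fin m) (Fin n) ℝ) (t : ℕ → ℝ),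
    (∀ i, Y i ∈ S) ∧ (∀ i, 0 < t i) ∧
    Filter.Tendsto Y Filter.atTop (nhds X) ∧
    Filter.Tendsto (fun i => (t i)⁻¹ • (Y i - X)) Filter.atTop (nhds Z)}

/-- The polynomial `f` rewritten in the variables shifted by the point `X`:
`(polyShift X f)(Y) = f(X + Y)`. -/
noncomputable def polyShift {m n : ℕ} (X : Matrix (Fin m) (Fin n) ℝ)
    (f : MvPolynomial (Fin m × Fin n) ℝ) : MvPolynomial (Fin m × Fin n) ℝ :=
  MvPolynomial.aeval (fun p : Fin m × Fin n =>
    MvPolynomial.X p + MvPolynomial.C (X p.1 p.2)) f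

/-- The algebraic tangent cone to a set `A` of real `m × n` matrices (viewed as a subset
of `ℝ^{mn}`) at a point `X`: the common zero set of the initial polynomials at `X`
(the lowest-degree nonzero homogeneous components in the shifted variables) of all
polynomials vanishing identically on `A`. -/
def algTangentCone {m n : ℕ} (A : Set (Matrix (Fin m) (Fin n) ℝ))
    (X : Matrix (Fin m) (Fin n) ℝ) : Set (Matrix (Fin m) (Fin n) ℝ) :=
  {Z | ∀ f : MvPolynomial (Fin m × Fin n) ℝ,
    (∀ Y ∈ A, MvPolynomial.eval (fun p : Fin m × Fin n => Y p.1 p.2) f = 0) →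
    ∀ k : ℕ,
      (∀ j < k, MvPolynomial.homogeneousComponent j (polyShift X f) = 0) →
      MvPolynomial.homogeneousComponent k (polyShift X f) ≠ 0 →
      MvPolynomial.eval (fun p : Fin m × Fin n => Z p.1 p.2)
        (MvPolynomial.homogeneousComponent k (polyShift X f)) = 0}

lemma MvPolynomial.IsHomogeneous.eval_smul_point {σ R : Type*} [Fintype σ] [CommSemiring R]
    {p : MvPolynomial σ R} {k : ℕ} (hp : p.IsHomogeneous k) (c : R) (x : σ → R) :
    MvPolynomial.eval (c • x) p = c ^ k * MvPolynomial.eval x p := by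
  rw [MvPolynomial.eval_eq', MvPolynomial.eval_eq', Finset.mul_sum]
  refine Finset.sum_congr rfl fun d hd => ?_
  have hdeg : ∑ i, d i = k := by
    rw [← hp (MvPolynomial.mem_support_iff.mp hd), Finsupp.weight_apply, Finsupp.sum_fintype]
    · simp
    · simp
  simp only [Pi.smul_apply, smul_eq_mul, mul_pow, Finset.prod_mul_distrib,
    Finset.prod_pow_eq_pow_sum, hdeg]
  ring

lemma MvPolynomial.eval_smul_point_eq_sum {σ R : Type*} [Fintype σ] [CommSemiring R]
    (g : MvPolynomial σ R) (c : R) (x : σ → R) :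
    MvPolynomial.eval (c • x) g = ∑ j ∈ Finset.range (g.totalDegree + 1),
      c ^ j * MvPolynomial.eval x (MvPolynomial.homogeneousComponent j g) := by
  conv_lhs => rw [← MvPolynomial.sum_homogeneousComponent g, map_sum]
  exact Finset.sum_congr rfl fun j _ =>
    (MvPolynomial.homogeneousComponent_isHomogeneous j g).eval_smul_point c x

/-- If the restriction of `g` to the line through `x` is the polynomial `p`, then the values at
`x` of the homogeneous components of `g` are the coefficients of `p`. -/
lemma MvPolynomial.eval_homogeneousComponent_of_eval_smul_point {σ R : Type*} [Fintype σ]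
    [CommRing R] [IsDomain R] [Infinite R] {g : MvPolynomial σ R} {x : σ → R}
    {p : Polynomial R} (h : ∀ c : R, MvPolynomial.eval (c • x) g = p.eval c) (j : ℕ) :
    MvPolynomial.eval x (MvPolynomial.homogeneousComponent j g) = p.coeff j := by
  have hp : p = ∑ i ∈ Finset.range (g.totalDegree + 1),
      Polynomial.C (MvPolynomial.eval x (MvPolynomial.homogeneousComponent i g)) *
        Polynomial.X ^ i := by
    refine Polynomial.funext fun c => ?_
    rw [← h, MvPolynomial.eval_smul_point_eq_sum, Polynomial.eval_finsetSum]
    exact Finset.sum_congr rfl fun i _ => by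
      rw [Polynomial.eval_mul, Polynomial.eval_pow, Polynomial.eval_X, Polynomial.eval_C, mul_comm]
  rw [hp, Polynomial.finsetSum_coeff]
  simp only [Polynomial.coeff_C_mul_X_pow, Finset.sum_ite_eq, Finset.mem_range]
  split_ifs with hj
  · rfl
  · rw [MvPolynomial.homogeneousComponent_eq_zero _ _ (by omega), map_zero]

lemma eval_polyShift {m n : ℕ} (X Y : Matrix (Fin m) (Fin n) ℝ)
    (f : MvPolynomial (Fin m × Fin n) ℝ) :
    MvPolynomial.eval (fun p => Y p.1 p.2) (polyShift X f) =
      MvPolynomial.eval (fun p => (X + Y) p.1 p.2) f := by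
  unfold polyShift
  induction f using MvPolynomial.induction_on with
  | C a => simp
  | add p q hp hq => rw [map_add, map_add, map_add, hp, hq]
  | mul_X p i hp =>
    rw [map_mul, map_mul, map_mul, hp]
    simp [add_comm]

lemma Matrix.exists_mul_mul_eq_one {K ι κ : Type*} [Field K] [Fintype ι] [DecidableEq ι]
    [Fintype κ] [DecidableEq κ] (A : Matrix ι κ K) {d : ℕ} (hd : d ≤ A.rank) :
    ∃ (M : Matrix (Fin d) ι K) (N : Matrix κ (Fin d) K), M * A * N = 1 := by
  obtain ⟨v, hv⟩ := exists_linearIndependent_of_le_finrank (R := K) hd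
  choose w hw using fun i => (v i).2
  have hcol : (A * (Matrix.of w)ᵀ).col = fun i => (v i : ι → K) := by
    funext i j
    exact congrFun (hw i) j
  have hinj : Function.Injective (A * (Matrix.of w)ᵀ).mulVec := by
    rw [Matrix.mulVec_injective_iff, hcol]
    exact hv.map' _ (Submodule.ker_subtype _)
  obtain ⟨g, hg⟩ := LinearMap.exists_leftInverse_of_injective (A * (Matrix.of w)ᵀ).mulVecLin
    (LinearMap.ker_eq_bot.mpr hinj)
  refine ⟨LinearMap.toMatrix' g, (Matrix.of w)ᵀ, ?_⟩
  rw [Matrix.mul_assoc, ← LinearMap.toMatrix'_id, ← hg, LinearMap.toMatrix'_comp,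
    ← Matrix.toLin'_apply', LinearMap.toMatrix'_toLin']

lemma Matrix.mul_mul_mul_eq_self_of_mul_mul_eq_one {K ι κ : Type*} [Field K] [Fintype ι]
    [Fintype κ] [DecidableEq κ] {A : Matrix ι κ K} {d : ℕ} (hd : A.rank ≤ d)
    {M : Matrix (Fin d) ι K} {N : Matrix κ (Fin d) K} (h : M * A * N = 1) :
    A * (N * M) * A = A := by
  have hle : LinearMap.range (A * N).mulVecLin ≤ LinearMap.range A.mulVecLin := by
    rw [Matrix.mulVecLin_mul]
    exact LinearMap.range_comp_le_range _ _
  have hrank : d ≤ (A * N).rank := by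
    have := Matrix.rank_mul_le_right M (A * N)
    rwa [← Matrix.mul_assoc, h, Matrix.rank_one, Fintype.card_fin] at this
  have heq := Submodule.eq_of_le_of_finrank_le hle (hd.trans hrank)
  have hcol : ∀ j : κ, ∃ k, (A * N) *ᵥ k = A.col j := fun j => by
    have : A *ᵥ Pi.single j 1 ∈ LinearMap.range (A * N).mulVecLin := by
      rw [heq]
      exact ⟨_, rfl⟩
    obtain ⟨k, hk⟩ := this
    exact ⟨k, by simpa using hk⟩
  choose k hk using hcol
  have hA : A * N * (Matrix.of k)ᵀ = A := by
    ext i j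
    exact congrFun (hk j) i
  calc A * (N * M) * A = A * (N * M) * (A * N * (Matrix.of k)ᵀ) := by rw [hA]
    _ = A * N * (M * A * N) * (Matrix.of k)ᵀ := by simp only [Matrix.mul_assoc]
    _ = A := by rw [h, Matrix.mul_one, hA]

lemma Matrix.rank_add_le_rank_add_rank {K ι κ : Type*} [Field K] [Fintype ι] [Fintype κ]
    (A B : Matrix ι κ K) : (A + B).rank ≤ A.rank + B.rank := by
  unfold Matrix.rank
  rw [Matrix.mulVecLin_add]
  exact (Submodule.finrank_mono (LinearMap.range_add_le _ _)).trans
    (Submodule.finrank_add_le_finrank_add_finrank _ _)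

lemma seqTangentCone_subset_algTangentCone {m n : ℕ} (A : Set (Matrix (Fin m) (Fin n) ℝ))
    {X : Matrix (Fin m) (Fin n) ℝ} (hX : X ∈ A) :
    seqTangentCone A X ⊆ algTangentCone A X := by
  rintro Z ⟨Y, t, hY, ht, hYX, hlim⟩ f hf k hlow hk
  set g := polyShift X f with hg
  have hcont : ∀ p : MvPolynomial (Fin m × Fin n) ℝ, Continuous
      fun W : Matrix (Fin m) (Fin n) ℝ => MvPolynomial.eval (fun q => W q.1 q.2) p := fun p =>
    (MvPolynomial.continuous_eval p).comp (by fun_prop)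
  by_cases hZ : Z = 0
  · subst hZ
    rcases Nat.eq_zero_or_pos k with rfl | hkpos
    · refine absurd ?_ hk
      have h0 := eval_polyShift X 0 f
      rw [add_zero, hf X hX, ← hg] at h0
      rw [MvPolynomial.homogeneousComponent_zero, ← MvPolynomial.constantCoeff_eq,
        ← MvPolynomial.eval_zero]
      simpa using h0
    · have := (MvPolynomial.homogeneousComponent_isHomogeneous k g).eval_smul_point (0 : ℝ) 0
      rw [zero_pow hkpos.ne', zero_mul, zero_smul] at this
      exact this
  obtain ⟨a, b, hab⟩ : ∃ a b, Z a b ≠ 0 := by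
    by_contra! h
    exact hZ (Matrix.ext h)
  have hlim0 : Filter.Tendsto t Filter.atTop (nhds 0) := by
    have h1 : Filter.Tendsto (fun i => (Y i - X) a b) Filter.atTop (nhds 0) := by
      have h := ((continuous_apply_apply a b).tendsto (X - X)).comp (hYX.sub_const X)
      rw [sub_self] at h
      exact h
    have h2 : Filter.Tendsto (fun i => ((t i)⁻¹ • (Y i - X)) a b) Filter.atTop (nhds (Z a b)) :=
      ((continuous_apply_apply a b).tendsto Z).comp hlim
    have h3 := h1.div h2 hab
    rw [zero_div] at h3
    refine h3.congr' ?_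
    filter_upwards [h2.eventually_ne hab] with i hi
    rw [Pi.div_apply, div_eq_iff hi, Matrix.smul_apply, smul_eq_mul,
      mul_inv_cancel_left₀ (ht i).ne']
  set W := fun i => (t i)⁻¹ • (Y i - X) with hW
  have hzero : ∀ i, ∑ j ∈ Finset.range (g.totalDegree + 1), t i ^ (j - k) *
      MvPolynomial.eval (fun q => W i q.1 q.2) (MvPolynomial.homogeneousComponent j g) = 0 := by
    intro i
    have h0 : MvPolynomial.eval (t i • fun q : Fin m × Fin n => W i q.1 q.2) g = 0 := by
      have h := eval_polyShift X (t i • W i) f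
      rw [hW, smul_inv_smul₀ (ht i).ne', add_sub_cancel, hf _ (hY i)] at h
      convert h using 3
      funext q
      simp [hW, (ht i).ne']
    rw [MvPolynomial.eval_smul_point_eq_sum] at h0
    refine (mul_eq_zero.mp (?_ : t i ^ k * _ = 0)).resolve_left (pow_ne_zero _ (ht i).ne')
    rw [Finset.mul_sum, ← h0]
    refine Finset.sum_congr rfl fun j _ => ?_
    rcases lt_or_ge j k with hj | hj
    · rw [hlow j hj]
      simp
    · rw [← mul_assoc, ← pow_add, Nat.add_sub_cancel' hj]
  have hsum : Filter.Tendsto (fun i => ∑ j ∈ Finset.range (g.totalDegree + 1), t i ^ (j - k) *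
      MvPolynomial.eval (fun q => W i q.1 q.2) (MvPolynomial.homogeneousComponent j g))
      Filter.atTop (nhds (∑ j ∈ Finset.range (g.totalDegree + 1), 0 ^ (j - k) *
      MvPolynomial.eval (fun q => Z q.1 q.2) (MvPolynomial.homogeneousComponent j g))) :=
    tendsto_finsetSum _ fun j _ => (hlim0.pow _).mul (((hcont _).tendsto Z).comp hlim)
  simp only [hzero] at hsum
  have := tendsto_nhds_unique tendsto_const_nhds hsum
  rw [Finset.sum_eq_single k] at this
  · simpa using this.symm
  · intro j _ hj
    rcases lt_or_gt_of_ne hj with hj | hj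
    · rw [hlow j hj]
      simp
    · rw [zero_pow (by omega), zero_mul]
  · intro hkr
    rw [MvPolynomial.homogeneousComponent_eq_zero _ _ (by simpa using hkr)]
    simp

/-- A curve of matrices of rank at most `r` through `X` with velocity
`L * X + X * R + E`. -/
lemma mem_seqTangentCone_of_eq {m n r : ℕ} {X Z E : Matrix (Fin m) (Fin n) ℝ}
    (L : Matrix (Fin m) (Fin m) ℝ) (R : Matrix (Fin n) (Fin n) ℝ)
    (hZ : Z = L * X + X * R + E) (hr : X.rank + E.rank ≤ r) :
    Z ∈ seqTangentCone {Y : Matrix (Fin m) (Fin n) ℝ | Y.rank ≤ r} X := by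
  have hexp : ∀ t : ℝ, (1 + t • L) * X * (1 + t • R) + t • E - X = t • (Z + t • (L * X * R)) := by
    intro t
    rw [hZ]
    simp only [Matrix.add_mul, Matrix.mul_add, Matrix.one_mul, Matrix.mul_one, Matrix.smul_mul,
      Matrix.mul_smul, smul_add]
    abel
  have ht : Filter.Tendsto (fun i : ℕ => (1 : ℝ) / (i + 1)) Filter.atTop (nhds 0) :=
    tendsto_one_div_add_atTop_nhds_zero_nat
  refine ⟨fun i => (1 + ((1 : ℝ) / (i + 1)) • L) * X * (1 + ((1 : ℝ) / (i + 1)) • R) +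
    ((1 : ℝ) / (i + 1)) • E, fun i => 1 / (i + 1), fun i => ?_, fun i => by positivity, ?_, ?_⟩
  · refine (Matrix.rank_add_le_rank_add_rank _ _).trans (le_trans (Nat.add_le_add ?_ ?_) hr)
    · exact (Matrix.rank_mul_le_left _ _).trans (Matrix.rank_mul_le_right _ _)
    · calc _ = ((((1 : ℝ) / (i + 1)) • (1 : Matrix (Fin m) (Fin m) ℝ)) * E).rank := by simp
        _ ≤ _ := Matrix.rank_mul_le_right _ _
  · have hc : Continuous fun t : ℝ => (1 + t • L) * X * (1 + t • R) + t • E := by fun_prop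
    have h := (hc.tendsto 0).comp ht
    simp only [zero_smul, add_zero, Matrix.one_mul, Matrix.mul_one] at h
    exact h
  · have hc : Continuous fun t : ℝ => Z + t • (L * X * R) := by fun_prop
    have h := (hc.tendsto 0).comp ht
    rw [zero_smul, add_zero] at h
    refine h.congr fun i => ?_
    rw [hexp, inv_smul_smul₀ (by positivity)]
    rfl

/-- The determinant of `P * Y * Q`, as a polynomial in the entries of `Y`. -/
noncomputable def compressionDet {m n : ℕ} {ι : Type*} [Fintype ι] [DecidableEq ι]
    (P : Matrix ι (Fin m) ℝ) (Q : Matrix (Fin n) ι ℝ) : MvPolynomial (Fin m × Fin n) ℝ :=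
  Matrix.det ((P.map MvPolynomial.C : Matrix ι (Fin m) (MvPolynomial (Fin m × Fin n) ℝ)) *
    (Matrix.of fun i j => MvPolynomial.X (i, j) :
      Matrix (Fin m) (Fin n) (MvPolynomial (Fin m × Fin n) ℝ)) *
    (Q.map MvPolynomial.C : Matrix (Fin n) ι (MvPolynomial (Fin m × Fin n) ℝ)))

lemma eval_compressionDet {m n : ℕ} {ι : Type*} [Fintype ι] [DecidableEq ι]
    (P : Matrix ι (Fin m) ℝ) (Q : Matrix (Fin n) ι ℝ) (Y : Matrix (Fin m) (Fin n) ℝ) :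
    MvPolynomial.eval (fun p => Y p.1 p.2) (compressionDet P Q) = (P * Y * Q).det := by
  rw [compressionDet, RingHom.map_det, RingHom.mapMatrix_apply, Matrix.map_mul, Matrix.map_mul]
  congr
  · ext; simp
  · ext; simp
  · ext; simp

lemma Matrix.det_mul_mul_eq_zero_of_rank_lt {K ι κ μ : Type*} [Field K] [Fintype ι]
    [DecidableEq ι] [Fintype κ] [Fintype μ] (P : Matrix ι κ K) (Y : Matrix κ μ K)
    (Q : Matrix μ ι K) (h : Y.rank < Fintype.card ι) : (P * Y * Q).det = 0 := by
  by_contra hdet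
  have h1 := Matrix.rank_of_det_ne_zero hdet
  have h2 := (Matrix.rank_mul_le_left (P * Y) Q).trans (Matrix.rank_mul_le_right P Y)
  omega

/-- The determinant of the compression, to a block frame adapted to `X`, of a line `X + t • Z`
vanishes at `t = 0` to order at least `d`, with `d`-th coefficient the determinant of the
compression of `Z` to the second block. -/
lemma exists_polynomial_eval_det_line {m n s d : ℕ} {X : Matrix (Fin m) (Fin n) ℝ}
    {M₀ : Matrix (Fin s) (Fin m) ℝ} {N₀ : Matrix (Fin n) (Fin s) ℝ} (h₀ : M₀ * X * N₀ = 1)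
    {M : Matrix (Fin d) (Fin m) ℝ} {N : Matrix (Fin n) (Fin d) ℝ}
    (hM : M * X = 0) (hN : X * N = 0) (Z : Matrix (Fin m) (Fin n) ℝ) :
    ∃ q : Polynomial ℝ, q.eval 0 = (M * Z * N).det ∧ ∀ t : ℝ,
      (Matrix.fromRows M₀ M * (X + t • Z) * Matrix.fromCols N₀ N).det =
        (Polynomial.X ^ d * q).eval t := by
  let B : Matrix (Fin s ⊕ Fin d) (Fin s ⊕ Fin d) (Polynomial ℝ) := Matrix.fromBlocks
    (1 + (Polynomial.X : Polynomial ℝ) • (M₀ * Z * N₀).map Polynomial.C)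
    ((M₀ * Z * N).map Polynomial.C)
    ((Polynomial.X : Polynomial ℝ) • (M * Z * N₀).map Polynomial.C) ((M * Z * N).map Polynomial.C)
  have hB : ∀ t : ℝ, B.det.eval t = (Matrix.fromBlocks (1 + t • (M₀ * Z * N₀)) (M₀ * Z * N)
      (t • (M * Z * N₀)) (M * Z * N)).det := by
    intro t
    rw [← Polynomial.coe_evalRingHom, RingHom.map_det, RingHom.mapMatrix_apply,
      Matrix.fromBlocks_map]
    congr 2 <;> ext i j <;> simp [-Matrix.map_mul, Matrix.one_apply, apply_ite]
    all_goals exact mul_comm _ _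
  refine ⟨B.det, ?_, fun t => ?_⟩
  · rw [hB, zero_smul, zero_smul, add_zero, Matrix.det_fromBlocks_zero₂₁, Matrix.det_one, one_mul]
  · have hblocks : Matrix.fromRows M₀ M * (X + t • Z) * Matrix.fromCols N₀ N =
        Matrix.fromBlocks (1 + t • (M₀ * Z * N₀)) (M₀ * Z * N) (t • (M * Z * N₀)) (M * Z * N) *
          Matrix.fromBlocks 1 0 0 (t • 1) := by
      rw [Matrix.fromRows_mul, Matrix.fromRows_mul_fromCols, Matrix.fromBlocks_multiply]
      simp [Matrix.mul_add, Matrix.add_mul, h₀, hM, Matrix.mul_assoc M₀ X N, hN]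
    rw [hblocks, Matrix.det_mul, ← hB, Matrix.det_fromBlocks_zero₂₁]
    rw [Polynomial.eval_mul, Polynomial.eval_pow, Polynomial.eval_X, Matrix.det_one, one_mul,
      Matrix.det_smul, Matrix.det_one, mul_one, Fintype.card_fin, mul_comm]

lemma rank_le_of_mem_algTangentCone {m n r : ℕ} {X Z : Matrix (Fin m) (Fin n) ℝ}
    (hZ : Z ∈ algTangentCone {Y : Matrix (Fin m) (Fin n) ℝ | Y.rank ≤ r} X)
    {L : Matrix (Fin m) (Fin m) ℝ} {R : Matrix (Fin n) (Fin n) ℝ}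
    (hL : L * X = 0) (hR : X * R = 0) : X.rank + (L * Z * R).rank ≤ r := by
  by_contra! hlt
  obtain ⟨s, hs⟩ : ∃ s, s = X.rank := ⟨_, rfl⟩
  obtain ⟨d, hd⟩ : ∃ d, d = (L * Z * R).rank := ⟨_, rfl⟩
  obtain ⟨M₀, N₀, h₀⟩ := X.exists_mul_mul_eq_one hs.le
  obtain ⟨M, N, h⟩ := (L * Z * R).exists_mul_mul_eq_one hd.le
  rw [← hs, ← hd] at hlt
  have hM : M * L * X = 0 := by rw [Matrix.mul_assoc, hL, Matrix.mul_zero]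
  have hN : X * (R * N) = 0 := by rw [← Matrix.mul_assoc, hR, Matrix.zero_mul]
  have hMZN : M * L * Z * (R * N) = 1 := by simpa only [Matrix.mul_assoc] using h
  set f := compressionDet (Matrix.fromRows M₀ (M * L)) (Matrix.fromCols N₀ (R * N)) with hf
  have hline : ∀ W : Matrix (Fin m) (Fin n) ℝ, ∃ q : Polynomial ℝ,
      q.eval 0 = (M * L * W * (R * N)).det ∧ ∀ t : ℝ,
        MvPolynomial.eval (t • fun p : Fin m × Fin n => W p.1 p.2) (polyShift X f) =
          (Polynomial.X ^ d * q).eval t := by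
    intro W
    obtain ⟨q, hq0, hq⟩ := exists_polynomial_eval_det_line h₀ hM hN W
    refine ⟨q, hq0, fun t => ?_⟩
    rw [← hq, ← eval_compressionDet, ← eval_polyShift]
    rfl
  have heval : MvPolynomial.eval (fun p : Fin m × Fin n => Z p.1 p.2)
      (MvPolynomial.homogeneousComponent d (polyShift X f)) = 1 := by
    obtain ⟨q, hq0, hq⟩ := hline Z
    rw [MvPolynomial.eval_homogeneousComponent_of_eval_smul_point hq,
      Polynomial.coeff_X_pow_mul', if_pos le_rfl, Nat.sub_self, Polynomial.coeff_zero_eq_eval_zero,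
      hq0, hMZN, Matrix.det_one]
  refine one_ne_zero (heval.symm.trans (hZ f (fun Y hY => ?_) d (fun j hj => ?_) ?_))
  · rw [hf, eval_compressionDet]
    refine Matrix.det_mul_mul_eq_zero_of_rank_lt _ _ _ ?_
    rw [Fintype.card_sum, Fintype.card_fin, Fintype.card_fin]
    exact lt_of_le_of_lt hY hlt
  · refine MvPolynomial.funext fun x => ?_
    obtain ⟨q, -, hq⟩ := hline (Matrix.of fun i j => x (i, j))
    rw [map_zero]
    refine (MvPolynomial.eval_homogeneousComponent_of_eval_smul_point hq j).trans ?_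
    rw [Polynomial.coeff_X_pow_mul', if_neg (by omega)]
  · intro h0
    rw [h0, map_zero] at heval
    exact zero_ne_one heval

/-- the tangent cone (in the sense of sequences) and the algebraic tangent
cone to the real generic determinantal variety `ℝ_{≤r}^{m×n}` coincide at every point. -/
theorem seqTangentCone_eq_algTangentCone
    {m n r : ℕ} (hr : r < min m n)
    (X : Matrix (Fin m) (Fin n) ℝ) (hX : X.rank ≤ r) :
    seqTangentCone {Y : Matrix (Fin m) (Fin n) ℝ | Y.rank ≤ r} X
      = algTangentCone {Y : Matrix (Fin m) (Fin n) ℝ | Y.rank ≤ r} X := by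
  refine (seqTangentCone_subset_algTangentCone _ hX).antisymm fun Z hZ => ?_
  obtain ⟨M, N, h⟩ := X.exists_mul_mul_eq_one le_rfl
  have hG := Matrix.mul_mul_mul_eq_self_of_mul_mul_eq_one le_rfl h
  set G := N * M
  refine mem_seqTangentCone_of_eq ((1 - X * G) * Z * G) (G * Z)
    (E := (1 - X * G) * Z * (1 - G * X)) ?_ (rank_le_of_mem_algTangentCone hZ ?_ ?_)
  · simp only [Matrix.sub_mul, Matrix.mul_sub, Matrix.one_mul, Matrix.mul_one, Matrix.mul_assoc]
    abel
  · rw [Matrix.sub_mul, Matrix.one_mul, hG, sub_self]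
  · rw [Matrix.mul_sub, Matrix.mul_one, ← Matrix.mul_assoc, hG, sub_self]
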